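/- Let k, d_in be positive integers with k ≤ d_in ≤ k². Let U, V ∈ ℝ^{k × d_in} be random matrices whose entries are independent and identically distributed standard Gaussian random variables (i.e., the joint law of the entries of (U, V) is the product measure of standard Gaussians N(0,1)). Then almost surely the Khatri-Rao product U ⊙ V ∈ ℝ^{k² × d_in} has full column rank, i.e., rank(U ⊙ V) = d_in almost surely. -/

import Mathlib

open MeasureTheory ProbabilityTheory

/-- The Khatri-Rao (column-wise Kronecker) product of `U : ℝ^{a × c}` and `V : ℝ^{b × c}`:
the matrix in `ℝ^{ab × c}` whose entry in row `r = (i-1)·b + l` (0-based: `r = i·b + l` with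
`i = r / b`, `l = r % b`) and column `j` is `U i j * V l j`. -/
def khatriRao {a b c : ℕ} (U : Matrix (Fin a) (Fin c) ℝ) (V : Matrix (Fin b) (Fin c) ℝ) :
    Matrix (Fin (a * b)) (Fin c) ℝ :=
  fun r j =>
    U ⟨r.1 / b, Nat.div_lt_of_lt_mul (Nat.mul_comm a b ▸ r.2)⟩ j *
    V ⟨r.1 % b, Nat.mod_lt _ (by
      rcases Nat.eq_zero_or_pos b with hb | hb
      · exact absurd r.2 (by simp [hb])
      · exact hb)⟩ j

/-- A nonzero polynomial in `n` variables is almost everywhere nonzero with respect to a product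
of `σ`-finite measures without atoms. -/
theorem MvPolynomial.ae_eval_ne_zero_fin {n : ℕ} (μ : Fin n → Measure ℝ)
    [∀ i, SigmaFinite (μ i)] [∀ i, NullSingletonClass (μ i)]
    {p : MvPolynomial (Fin n) ℝ} (hp : p ≠ 0) :
    ∀ᵐ x ∂Measure.pi μ, MvPolynomial.eval x p ≠ 0 := by
  induction n with
  | zero =>
    refine ae_of_all _ fun x hx => hp ?_
    rw [MvPolynomial.eq_C_of_isEmpty p] at hx ⊢
    simpa using hx
  | succ n ih =>
    have hq : MvPolynomial.finSuccEquiv ℝ n p ≠ 0 := by simpa using hp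
    obtain ⟨i, hi⟩ : ∃ i, (MvPolynomial.finSuccEquiv ℝ n p).coeff i ≠ 0 := by
      by_contra! h
      exact hq (Polynomial.ext fun i => by simpa using h i)
    have hcons : Measurable fun z : ℝ × (Fin n → ℝ) => (Fin.cons z.1 z.2 : Fin (n + 1) → ℝ) :=
      measurable_pi_lambda _ fun j => by
        refine Fin.cases ?_ (fun j => ?_) j
        · simpa using measurable_fst
        · simp only [Fin.cons_succ]
          fun_prop
    have hmeas : MeasurableSet {z : ℝ × (Fin n → ℝ) |
        MvPolynomial.eval (Fin.cons z.1 z.2 : Fin (n + 1) → ℝ) p ≠ 0} :=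
      ((MvPolynomial.continuous_eval p).measurable.comp hcons) (measurableSet_singleton 0).compl
    have hprod : ∀ᵐ z ∂(μ 0).prod (Measure.pi fun j => μ (Fin.succ j)),
        MvPolynomial.eval (Fin.cons z.1 z.2 : Fin (n + 1) → ℝ) p ≠ 0 := by
      rw [Measure.ae_prod_iff_ae_ae hmeas,
        Measure.ae_ae_comm (p := fun y s =>
          MvPolynomial.eval (Fin.cons y s : Fin (n + 1) → ℝ) p ≠ 0) hmeas]
      filter_upwards [ih (fun j => μ (Fin.succ j)) hi] with s hs
      have hmap : (MvPolynomial.finSuccEquiv ℝ n p).map (MvPolynomial.eval s) ≠ 0 := fun h =>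
        hs (by simpa using congrArg (fun q => q.coeff i) h)
      refine measure_mono_null (fun y hy => ?_)
        ((Polynomial.finite_setOfPred_isRoot hmap).measure_zero (μ 0))
      simpa [MvPolynomial.eval_eq_eval_mv_eval'] using hy
    have hmp := measurePreserving_piFinSuccAbove μ 0
    filter_upwards [hmp.quasiMeasurePreserving.ae hprod] with x hx
    have hx' : (Fin.cons (x 0) (fun j => x (Fin.succ j)) : Fin (n + 1) → ℝ) = x :=
      Fin.cons_self_tail x
    rw [← hx']
    exact hx

/-- A nonzero polynomial in finitely many variables is almost everywhere nonzero with respect to a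
product of `σ`-finite measures without atoms. -/
theorem MvPolynomial.ae_eval_ne_zero {ι : Type*} [Fintype ι] (μ : ι → Measure ℝ)
    [∀ i, SigmaFinite (μ i)] [∀ i, NullSingletonClass (μ i)]
    {p : MvPolynomial ι ℝ} (hp : p ≠ 0) :
    ∀ᵐ x ∂Measure.pi μ, MvPolynomial.eval x p ≠ 0 := by
  let e := Fintype.equivFin ι
  have hq : MvPolynomial.rename e p ≠ 0 := fun h =>
    hp (MvPolynomial.rename_injective e e.injective (by simpa using h))
  have hmp := measurePreserving_arrowCongr' μ (fun i => μ (e.symm i)) e (MeasurableEquiv.refl ℝ)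
    (fun i => by rw [e.symm_apply_apply]; exact MeasurePreserving.id (μ i))
  filter_upwards [hmp.quasiMeasurePreserving.ae
    (MvPolynomial.ae_eval_ne_zero_fin (fun i => μ (e.symm i)) hq)] with x hx
  rw [MvPolynomial.eval_rename] at hx
  convert hx using 3
  ext i
  exact congrArg x (e.symm_apply_apply i).symm

/-- The square matrix of the first `c` rows of `khatriRao U V` is the identity for suitable
`0`-`1` matrices `U` and `V`. -/
theorem khatriRao_submatrix_castLE_eq_one {a b c : ℕ} (h : c ≤ a * b) :
    (khatriRao (fun (i : Fin a) (j : Fin c) => if i.1 = j.1 / b then 1 else 0)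
      (fun (l : Fin b) (j : Fin c) => if l.1 = j.1 % b then 1 else 0)).submatrix
        (Fin.castLE h) id = 1 := by
  ext r j
  have key : r = j ↔ r.1 / b = j.1 / b ∧ r.1 % b = j.1 % b := by
    refine ⟨by rintro rfl; simp, fun ⟨hd, hm⟩ => Fin.ext ?_⟩
    rw [← Nat.div_add_mod r.1 b, hd, hm, Nat.div_add_mod]
  simp only [khatriRao, Matrix.submatrix_apply, Matrix.one_apply, key, Fin.val_castLE, id,
    ite_and, ite_mul, one_mul, zero_mul]

/-- The determinant of the first `c` rows of the Khatri-Rao product is a nonzero polynomial in the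
entries of the factors. -/
theorem exists_mvPolynomial_eval_eq_det_khatriRao {a c : ℕ} (h : c ≤ a * a) :
    ∃ p : MvPolynomial (Fin 2 × Fin a × Fin c) ℝ, p ≠ 0 ∧ ∀ ω, MvPolynomial.eval ω p =
      ((khatriRao (fun i j => ω (0, i, j)) (fun i j => ω (1, i, j))).submatrix
        (Fin.castLE h) id).det := by
  have ha (r : Fin c) : 0 < a :=
    Nat.pos_of_mul_pos_left ((Nat.zero_le _).trans_lt r.2 |>.trans_le h)
  let M : Matrix (Fin c) (Fin c) (MvPolynomial (Fin 2 × Fin a × Fin c) ℝ) := fun r j =>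
    MvPolynomial.X (0, ⟨r.1 / a, Nat.div_lt_of_lt_mul (r.2.trans_le h)⟩, j) *
      MvPolynomial.X (1, ⟨r.1 % a, Nat.mod_lt _ (ha r)⟩, j)
  have heval (ω) : MvPolynomial.eval ω M.det =
      ((khatriRao (fun i j => ω (0, i, j)) (fun i j => ω (1, i, j))).submatrix
        (Fin.castLE h) id).det := by
    rw [RingHom.map_det]
    congr 1
    ext r j
    rw [RingHom.mapMatrix_apply, Matrix.map_apply]
    simp [M, khatriRao]
  refine ⟨M.det, fun h0 => ?_, heval⟩
  have := heval fun x => if x.1 = 0 then (if x.2.1.1 = x.2.2.1 / a then 1 else 0)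
    else (if x.2.1.1 = x.2.2.1 % a then 1 else 0)
  simp only [one_ne_zero, if_true, if_false] at this
  rw [khatriRao_submatrix_castLE_eq_one h, h0] at this
  simp at this

/-- If the entries of `U, V ∈ ℝ^{k × d_in}`, with `k ≤ d_in ≤ k²`, are i.i.d. standard
Gaussian random variables, then almost surely the Khatri-Rao product `U ⊙ V ∈ ℝ^{k² × d_in}`
has full column rank `d_in`. -/
theorem khatriRao_gaussian_fullRank (k dIn : ℕ) (hk : 0 < k) (hdIn : 0 < dIn)
    (h₁ : k ≤ dIn) (h₂ : dIn ≤ k ^ 2) :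
    ∀ᵐ ω ∂(Measure.pi fun _ : Fin 2 × Fin k × Fin dIn => gaussianReal 0 1),
      (khatriRao (fun i j => ω (0, i, j)) (fun i j => ω (1, i, j))).rank = dIn := by
  have h : dIn ≤ k * k := by rwa [← sq]
  obtain ⟨p, hp, heval⟩ := exists_mvPolynomial_eval_eq_det_khatriRao h
  have : NullSingletonClass (gaussianReal 0 1) := nullSingletonClass_gaussianReal one_ne_zero
  filter_upwards [MvPolynomial.ae_eval_ne_zero (fun _ => gaussianReal 0 1) hp] with ω hω
  rw [heval, ← isUnit_iff_ne_zero, ← Matrix.isUnit_iff_isUnit_det] at hω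
  refine le_antisymm (by simpa using Matrix.rank_le_width _) ?_
  have hr := Matrix.rank_of_isUnit _ hω
  rw [Fintype.card_fin] at hr
  exact hr.symm.le.trans (Matrix.rank_submatrix_le _ _ _)
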